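/- arXiv:1607.05285 — 2 statements merged into one kernel-verified Lean document; each statement's English description precedes it below -/
import Mathlib

section
/- The function g_- is monotonically decreasing and convex on the cone of 2n×2n real symmetric positive definite matrices: if 0 < A ≤ B (Loewner order) then g_-(A) ≥ g_-(B), and for all 0 ≤ p ≤ 1 and all positive definite A, B, one has g_-(pA + (1−p)B) ≤ p·g_-(A) + (1−p)·g_-(B). -/
open Matrix
open scoped ComplexOrder Kronecker

noncomputable section

/-- The standard symplectic form on a single mode. -/
def J2 : Matrix (Fin 2) (Fin 2) ℝ := !![0, 1; -1, 0]

/-- The standard symplectic form on `n` modes: the direct sum of `n` copies of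
`[[0,1],[-1,0]]`, realized on the index type `Fin n × Fin 2`. -/
def Omega (n : ℕ) : Matrix (Fin n × Fin 2) (Fin n × Fin 2) ℝ :=
  (1 : Matrix (Fin n) (Fin n) ℝ) ⊗ₖ J2

/-- `V` is a quantum covariance matrix with respect to the symplectic form `Om`:
the complex matrix `V + i·Om` is positive semidefinite. -/
def QCM {ι : Type*} [Fintype ι] (Om V : Matrix ι ι ℝ) : Prop :=
  (V.map Complex.ofReal + Complex.I • Om.map Complex.ofReal).PosSemidef

/-- The positive semidefinite square root of a positive semidefinite matrix
(as defined in Mathlib of December 2024). -/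
def Matrix.PosSemidef.sqrt {n 𝕜 : Type*} [Fintype n] [RCLike 𝕜] [DecidableEq n]
    {A : Matrix n n 𝕜} (hA : A.PosSemidef) : Matrix n n 𝕜 :=
  hA.1.eigenvectorUnitary.1 * diagonal ((RCLike.ofReal : ℝ → 𝕜) ∘ Real.sqrt ∘ hA.1.eigenvalues) *
    (star hA.1.eigenvectorUnitary : Matrix n n 𝕜)

/-- The positive semidefinite square root of a positive semidefinite real matrix
(junk value `0` if the matrix is not positive semidefinite). -/
def msqrt {ι : Type*} [Fintype ι] [DecidableEq ι] (A : Matrix ι ι ℝ) : Matrix ι ι ℝ := by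
  classical exact if h : A.PosSemidef then h.sqrt else 0

/-- `g₋(A) = Σ_i max(−log ν_i, 0)` where `ν_1, …, ν_n` are the symplectic eigenvalues of `A`
(w.r.t. the symplectic form `Om`), i.e. the eigenvalues of the Hermitian matrix
`i·√A·Om·√A` are exactly `±ν_1, …, ±ν_n`; equivalently, half the sum of
`max(−log |λ|, 0)` over all eigenvalues `λ` of `i·√A·Om·√A`. -/
def gMinus {ι : Type*} [Fintype ι] [DecidableEq ι] (Om A : Matrix ι ι ℝ) : ℝ := by
  classical exact
    if h : (Complex.I • ((msqrt A * Om * msqrt A).map Complex.ofReal)).IsHermitian then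
      (∑ j, max (-Real.log |h.eigenvalues j|) 0) / 2
    else 0

/-- `g₊(A) = Σ_i max(log ν_i, 0)` where `ν_1, …, ν_n` are the symplectic eigenvalues of `A`
(w.r.t. the symplectic form `Om`). -/
def gPlus {ι : Type*} [Fintype ι] [DecidableEq ι] (Om A : Matrix ι ι ℝ) : ℝ := by
  classical exact
    if h : (Complex.I • ((msqrt A * Om * msqrt A).map Complex.ofReal)).IsHermitian then
      (∑ j, max (Real.log |h.eigenvalues j|) 0) / 2
    else 0

/-- Schur complement of the first (upper-left) diagonal block of a block matrix:
`M/M₁₁ = M₂₂ − M₂₁ M₁₁⁻¹ M₁₂`. -/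
def schurA {a b : Type*} [Fintype a] [DecidableEq a]
    (M : Matrix (a ⊕ b) (a ⊕ b) ℝ) : Matrix b b ℝ :=
  M.toBlocks₂₂ - M.toBlocks₂₁ * M.toBlocks₁₁⁻¹ * M.toBlocks₁₂

/-- Schur complement of the second (lower-right) diagonal block of a block matrix:
`M/M₂₂ = M₁₁ − M₁₂ M₂₂⁻¹ M₂₁`. -/
def schurB {a b : Type*} [Fintype b] [DecidableEq b]
    (M : Matrix (a ⊕ b) (a ⊕ b) ℝ) : Matrix a a ℝ :=
  M.toBlocks₁₁ - M.toBlocks₁₂ * M.toBlocks₂₂⁻¹ * M.toBlocks₂₁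

/-- Embedding of the `A ⊕ C` indices into `A ⊕ (B ⊕ C)`. -/
def embAC {a b c : Type*} : a ⊕ c → a ⊕ (b ⊕ c) :=
  Sum.elim Sum.inl (Sum.inr ∘ Sum.inr)

/-- Embedding of the `A ⊕ B` indices into `A ⊕ (B ⊕ C)`. -/
def embAB {a b c : Type*} : a ⊕ b → a ⊕ (b ⊕ c) :=
  Sum.elim Sum.inl (Sum.inr ∘ Sum.inl)


/-! ## Auxiliary lemmas -/

theorem aux_sqrt_mul {n 𝕜 : Type*} [Fintype n] [RCLike 𝕜] [DecidableEq n]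
    {A : Matrix n n 𝕜} (hA : A.PosSemidef) : hA.sqrt * hA.sqrt = A := by
  have h1 : (star hA.1.eigenvectorUnitary : Matrix n n 𝕜) * hA.1.eigenvectorUnitary.1 = 1 :=
    Unitary.coe_star_mul_self _
  have h2 := hA.1.spectral_theorem
  rw [Unitary.conjStarAlgAut_apply] at h2
  have h3 : diagonal ((RCLike.ofReal : ℝ → 𝕜) ∘ Real.sqrt ∘ hA.1.eigenvalues) *
      diagonal ((RCLike.ofReal : ℝ → 𝕜) ∘ Real.sqrt ∘ hA.1.eigenvalues)
      = diagonal ((RCLike.ofReal : ℝ → 𝕜) ∘ hA.1.eigenvalues) := by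
    rw [diagonal_mul_diagonal]
    congr 1
    funext i
    simp only [Function.comp]
    rw [← RCLike.ofReal_mul, Real.mul_self_sqrt (hA.eigenvalues_nonneg i)]
  calc hA.sqrt * hA.sqrt = hA.1.eigenvectorUnitary.1 *
        (diagonal ((RCLike.ofReal : ℝ → 𝕜) ∘ Real.sqrt ∘ hA.1.eigenvalues) *
        ((star hA.1.eigenvectorUnitary : Matrix n n 𝕜) * hA.1.eigenvectorUnitary.1) *
        diagonal ((RCLike.ofReal : ℝ → 𝕜) ∘ Real.sqrt ∘ hA.1.eigenvalues)) *
        (star hA.1.eigenvectorUnitary : Matrix n n 𝕜) := by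
          simp only [Matrix.PosSemidef.sqrt, Matrix.mul_assoc]
    _ = A := by
      rw [h1, Matrix.mul_one, h3]
      exact h2.symm

theorem aux_sqrt_herm {n 𝕜 : Type*} [Fintype n] [RCLike 𝕜] [DecidableEq n]
    {A : Matrix n n 𝕜} (hA : A.PosSemidef) : hA.sqrtᴴ = hA.sqrt := by
  unfold Matrix.PosSemidef.sqrt
  have h3 : (diagonal ((RCLike.ofReal : ℝ → 𝕜) ∘ Real.sqrt ∘ hA.1.eigenvalues))ᴴ =
      diagonal ((RCLike.ofReal : ℝ → 𝕜) ∘ Real.sqrt ∘ hA.1.eigenvalues) := by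
    rw [diagonal_conjTranspose]
    congr 1
    funext i
    simp
  rw [conjTranspose_mul, conjTranspose_mul, h3, star_eq_conjTranspose,
    conjTranspose_conjTranspose, Matrix.mul_assoc]

/-- Diagonalisation of a Hermitian matrix, in elementary form. -/
theorem aux_spectral {n : Type*} [Fintype n] [DecidableEq n]
    {H : Matrix n n ℂ} (hH : H.IsHermitian) :
    ∃ U : Matrix n n ℂ, U * Uᴴ = 1 ∧ Uᴴ * U = 1 ∧
      H = U * diagonal (fun i => (hH.eigenvalues i : ℂ)) * Uᴴ := by
  refine ⟨hH.eigenvectorUnitary.1, ?_, ?_, ?_⟩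
  · exact Unitary.coe_mul_star_self _
  · exact Unitary.coe_star_mul_self _
  · have h2 := hH.spectral_theorem
    rw [Unitary.conjStarAlgAut_apply] at h2
    exact h2

/-- Symmetrised Cauchy-Binet formula. -/
theorem aux_cauchy_binet {m ι : Type*} [Fintype m] [DecidableEq m] [Fintype ι] [DecidableEq ι]
    (M : Matrix m ι ℂ) (N : Matrix ι m ℂ) :
    (Fintype.card (Equiv.Perm m) : ℂ) * (M * N).det
      = ∑ f : m → ι, (M.submatrix id f).det * (N.submatrix f id).det := by
  have h1 : (M * N).det = ∑ f : m → ι, (M.submatrix id f).det * ∏ i, N (f i) i := by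
    simp only [det_apply', mul_apply, Finset.prod_univ_sum, Finset.mul_sum,
      Fintype.piFinset_univ, submatrix_apply, id, Finset.sum_mul]
    rw [Finset.sum_comm]
    simp only [Finset.prod_mul_distrib, mul_assoc]
  have h2 : ∀ τ : Equiv.Perm m, (M * N).det =
      ∑ f : m → ι, (M.submatrix id f).det *
        (((Equiv.Perm.sign τ : ℤ) : ℂ) * ∏ i, N (f (τ i)) i) := by
    intro τ
    rw [h1]
    refine Fintype.sum_equiv (Equiv.arrowCongr τ (Equiv.refl ι)) _ _ fun f => ?_
    have h3 : M.submatrix id f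
        = (M.submatrix id ((Equiv.arrowCongr τ (Equiv.refl ι)) f)).submatrix id τ := by
      ext i j
      simp
    rw [h3, det_permute']
    simp
    ring
  calc (Fintype.card (Equiv.Perm m) : ℂ) * (M * N).det
      = ∑ _τ : Equiv.Perm m, (M * N).det := by simp
    _ = ∑ τ : Equiv.Perm m, ∑ f : m → ι, (M.submatrix id f).det *
        (((Equiv.Perm.sign τ : ℤ) : ℂ) * ∏ i, N (f (τ i)) i) :=
          Finset.sum_congr rfl fun τ _ => h2 τ
    _ = _ := by
      rw [Finset.sum_comm]
      refine Finset.sum_congr rfl fun f _ => ?_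
      rw [← Finset.mul_sum]
      simp only [det_apply' (N.submatrix f id), submatrix_apply, id]

theorem aux_cb_diag {m ι : Type*} [Fintype m] [DecidableEq m] [Fintype ι] [DecidableEq ι]
    (W : Matrix ι m ℂ) (d : ι → ℝ) :
    (Fintype.card (Equiv.Perm m) : ℂ) * (Wᴴ * diagonal (fun i => (d i : ℂ)) * W).det
      = ((∑ f : m → ι, (∏ i, d (f i)) * ‖(W.submatrix f id).det‖ ^ 2 : ℝ) : ℂ) := by
  rw [aux_cauchy_binet]
  push_cast
  refine Finset.sum_congr rfl fun f _ => ?_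
  have h : (Wᴴ * diagonal (fun i => (d i : ℂ))).submatrix id f
      = of fun i j => (d (f j) : ℂ) * ((W.submatrix f id)ᴴ) i j := by
    ext i j
    simp [mul_comm]
  rw [h, det_mul_row, det_conjTranspose, mul_assoc, ← Complex.conj_mul']
  rfl

/-- Compression bound. -/
theorem aux_bound {m ι : Type*} [Fintype m] [DecidableEq m] [Fintype ι] [DecidableEq ι]
    (W : Matrix ι m ℂ) (d : ι → ℝ) :
    ‖(Wᴴ * diagonal (fun i => (d i : ℂ)) * W).det‖
      ≤ (∏ i, max |d i| 1) * ‖(Wᴴ * W).det‖ := by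
  have hc : (0 : ℝ) < (Fintype.card (Equiv.Perm m) : ℝ) := by
    exact_mod_cast Fintype.card_pos
  have h1 := congrArg norm (aux_cb_diag W d)
  have h2 := congrArg norm (aux_cb_diag W (fun _ => 1))
  simp only [Complex.ofReal_one, diagonal_one, Matrix.mul_one, Finset.prod_const_one,
    one_mul] at h2
  rw [norm_mul, Complex.norm_real, Complex.norm_natCast, Real.norm_eq_abs] at h1 h2
  rw [abs_of_nonneg (Finset.sum_nonneg fun f _ => sq_nonneg _)] at h2
  refine le_of_mul_le_mul_left ?_ hc
  rw [h1, mul_left_comm, h2, Finset.mul_sum]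
  refine (Finset.abs_sum_le_sum_abs _ _).trans (Finset.sum_le_sum fun f _ => ?_)
  rw [abs_mul, abs_of_nonneg (sq_nonneg ‖_‖)]
  by_cases hf : Function.Injective f
  · refine mul_le_mul_of_nonneg_right ?_ (sq_nonneg _)
    rw [Finset.abs_prod]
    calc ∏ i, |d (f i)| ≤ ∏ i, max |d (f i)| 1 :=
          Finset.prod_le_prod (fun i _ => abs_nonneg _) (fun i _ => le_max_left _ _)
      _ = ∏ j ∈ Finset.univ.map ⟨f, hf⟩, max |d j| 1 := by simp
      _ ≤ ∏ j, max |d j| 1 :=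
          Finset.prod_le_prod_of_subset_of_one_le (Finset.subset_univ _)
            (fun i _ => le_trans zero_le_one (le_max_right _ _)) (fun i _ _ => le_max_right _ _)
  · have : (W.submatrix f id).det = 0 := by
      simp only [Function.Injective, not_forall] at hf
      obtain ⟨i, j, hij, hne⟩ := hf
      refine det_zero_of_row_eq hne ?_
      funext k
      simp [hij]
    simp [this]

/-- Simultaneous diagonalisation of two positive definite matrices. -/
theorem aux_simdiag {m : Type*} [Fintype m] [DecidableEq m] {P Q : Matrix m m ℂ}
    (hP : P.PosDef) (hQ : Q.PosDef) :
    ∃ (R R' : Matrix m m ℂ) (q : m → ℝ), R * R' = 1 ∧ R' * R = 1 ∧ (∀ i, 0 < q i) ∧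
      P = R * Rᴴ ∧ Q = R * diagonal (fun i => (q i : ℂ)) * Rᴴ := by
  set T := hP.posSemidef.sqrt with hT
  have hTT : T * T = P := aux_sqrt_mul _
  have hTh : Tᴴ = T := aux_sqrt_herm _
  have hTu : IsUnit T.det := by
    have := (Matrix.isUnit_iff_isUnit_det _).1 hP.isUnit
    rw [← hTT, det_mul] at this
    exact isUnit_of_mul_isUnit_left this
  have hi1 : T * T⁻¹ = 1 := mul_nonsing_inv _ hTu
  have hi2 : T⁻¹ * T = 1 := nonsing_inv_mul _ hTu
  have hih : (T⁻¹)ᴴ = T⁻¹ := by rw [conjTranspose_nonsing_inv, hTh]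
  have hG : ((T⁻¹)ᴴ * Q * T⁻¹).PosDef := by
    refine hQ.conjTranspose_mul_mul_same ?_
    rw [mulVec_injective_iff_isUnit]
    exact IsUnit.of_mul_eq_one _ hi2
  rw [hih] at hG
  obtain ⟨U, hU1, hU2, hU⟩ := aux_spectral hG.1
  refine ⟨T * U, Uᴴ * T⁻¹, hG.1.eigenvalues, ?_, ?_, hG.eigenvalues_pos, ?_, ?_⟩
  · calc T * U * (Uᴴ * T⁻¹) = T * (U * Uᴴ) * T⁻¹ := by simp only [Matrix.mul_assoc]
      _ = 1 := by rw [hU1, Matrix.mul_one, hi1]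
  · calc Uᴴ * T⁻¹ * (T * U) = Uᴴ * (T⁻¹ * T) * U := by simp only [Matrix.mul_assoc]
      _ = 1 := by rw [hi2, Matrix.mul_one, hU2]
  · rw [conjTranspose_mul, hTh]
    calc P = T * (U * Uᴴ) * T := by rw [hU1, Matrix.mul_one, hTT]
      _ = _ := by simp only [Matrix.mul_assoc]
  · rw [conjTranspose_mul, hTh]
    calc Q = (T * T⁻¹) * Q * (T⁻¹ * T) := by rw [hi1, hi2, Matrix.mul_one, Matrix.one_mul]
      _ = T * (T⁻¹ * Q * T⁻¹) * T := by simp only [Matrix.mul_assoc]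
      _ = _ := by
        refine (congrArg (fun X => T * X * T) hU).trans ?_
        simp only [Matrix.mul_assoc]

theorem aux_logdet_mono {m : Type*} [Fintype m] [DecidableEq m] {P Q : Matrix m m ℂ}
    (hP : P.PosDef) (hQ : Q.PosDef) (hPQ : (Q - P).PosSemidef) :
    Real.log ‖P.det‖ ≤ Real.log ‖Q.det‖ := by
  obtain ⟨R, R', q, h1, h2, hq, hP', hQ'⟩ := aux_simdiag hP hQ
  have h2' : Rᴴ * R'ᴴ = 1 := by rw [← conjTranspose_mul, h2, conjTranspose_one]
  have hd : (diagonal (fun i => (q i : ℂ)) - 1).PosSemidef := by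
    have := hPQ.mul_mul_conjTranspose_same R'
    have e : R' * (Q - P) * R'ᴴ = diagonal (fun i => (q i : ℂ)) - 1 := by
      calc R' * (Q - P) * R'ᴴ = (R' * R) * diagonal (fun i => (q i : ℂ)) * (Rᴴ * R'ᴴ)
            - (R' * R) * (Rᴴ * R'ᴴ) := by
              rw [hP', hQ']
              simp only [Matrix.mul_sub, Matrix.sub_mul, Matrix.mul_assoc]
        _ = _ := by rw [h2, h2']; simp
    rwa [e] at this
  have hq1 : ∀ i, 1 ≤ q i := by
    intro i
    rw [← diagonal_one, diagonal_sub, posSemidef_diagonal_iff] at hd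
    have := hd i
    rw [sub_nonneg] at this
    exact_mod_cast this
  refine Real.log_le_log (norm_pos_iff.2 hP.det_pos.ne') ?_
  rw [hP', hQ', det_mul, det_mul, det_mul, det_diagonal, norm_mul, norm_mul, norm_mul]
  have : 1 ≤ ‖∏ i, (q i : ℂ)‖ := by
    rw [← Complex.ofReal_prod, Complex.norm_real, Real.norm_eq_abs]
    exact (Finset.one_le_prod fun i _ => hq1 i).trans (le_abs_self _)
  nlinarith [mul_nonneg (norm_nonneg R.det) (norm_nonneg Rᴴ.det)]

theorem aux_logdet_concave {m : Type*} [Fintype m] [DecidableEq m] {P Q : Matrix m m ℂ}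
    (hP : P.PosDef) (hQ : Q.PosDef) {p : ℝ} (hp0 : 0 ≤ p) (hp1 : p ≤ 1) :
    p * Real.log ‖P.det‖ + (1 - p) * Real.log ‖Q.det‖
      ≤ Real.log ‖((p : ℂ) • P + ((1 - p : ℝ) : ℂ) • Q).det‖ := by
  obtain ⟨R, R', q, h1, h2, hq, hP', hQ'⟩ := aux_simdiag hP hQ
  have hR : R.det ≠ 0 := by
    intro h
    have := congrArg det h1
    rw [det_mul, h, zero_mul, det_one] at this
    exact zero_ne_one this
  have hRh : Rᴴ.det ≠ 0 := by rw [det_conjTranspose]; simpa using hR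
  have key : ∀ r : m → ℝ, (∀ i, 0 < r i) →
      Real.log ‖(R * diagonal (fun i => (r i : ℂ)) * Rᴴ).det‖
        = Real.log ‖R.det * Rᴴ.det‖ + ∑ i, Real.log (r i) := by
    intro r hr
    have hpos : 0 < ∏ i, r i := Finset.prod_pos fun i _ => hr i
    rw [det_mul, det_mul, det_diagonal, mul_right_comm, norm_mul, Real.log_mul,
      ← Complex.ofReal_prod, Complex.norm_real, Real.norm_of_nonneg hpos.le,
      Real.log_prod (fun i _ => (hr i).ne')]
    · exact norm_ne_zero_iff.2 (mul_ne_zero hR hRh)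
    · rw [← Complex.ofReal_prod, Complex.norm_real]
      exact norm_ne_zero_iff.2 hpos.ne'
  have hr : ∀ i, 0 < p + (1 - p) * q i := by
    intro i
    rcases hp0.eq_or_lt with h | h
    · subst h; simpa using hq i
    · have := mul_nonneg (sub_nonneg.2 hp1) (hq i).le
      linarith
  have e : (p : ℂ) • P + ((1 - p : ℝ) : ℂ) • Q
      = R * diagonal (fun i => ((p + (1 - p) * q i : ℝ) : ℂ)) * Rᴴ := by
    have e1 : diagonal (fun i => ((p + (1 - p) * q i : ℝ) : ℂ))
        = (p : ℂ) • (1 : Matrix m m ℂ) + ((1 - p : ℝ) : ℂ) • diagonal (fun i => (q i : ℂ)) := by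
      rw [← diagonal_one, ← diagonal_smul, ← diagonal_smul, diagonal_add]
      congr 1
      funext i
      simp
    rw [e1, hP', hQ']
    simp [Matrix.mul_add, Matrix.add_mul]
  have eP : P = R * diagonal (fun i => (((fun _ => 1 : m → ℝ) i : ℝ) : ℂ)) * Rᴴ := by
    rw [hP']; simp
  rw [e, key _ hr, eP, key _ (fun _ => one_pos), hQ', key _ hq]
  have hlog : ∀ i, (1 - p) * Real.log (q i) ≤ Real.log (p + (1 - p) * q i) := by
    intro i
    have := strictConcaveOn_log_Ioi.concaveOn.2 (Set.mem_Ioi.2 one_pos) (Set.mem_Ioi.2 (hq i))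
      hp0 (sub_nonneg.2 hp1) (by ring)
    simpa using this
  have hs := Finset.sum_le_sum fun i (_ : i ∈ Finset.univ) => hlog i
  rw [← Finset.mul_sum] at hs
  simp only [Real.log_one, Finset.sum_const_zero]
  nlinarith [hs]

/-- The Hermitian matrix `i Ω`. -/
def auxK (n : ℕ) : Matrix (Fin n × Fin 2) (Fin n × Fin 2) ℂ :=
  Complex.I • (Omega n).map Complex.ofReal

theorem aux_Omega_sq (n : ℕ) : Omega n * Omega n = -1 := by
  have hJ : J2 * J2 = -1 := by
    ext i j
    fin_cases i <;> fin_cases j <;> simp [J2, Matrix.mul_apply]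
  unfold Omega
  rw [← mul_kronecker_mul, hJ, Matrix.one_mul]
  ext ⟨i, a⟩ ⟨j, b⟩
  rw [kroneckerMap_apply, Matrix.neg_apply, Matrix.neg_apply, one_apply, one_apply, one_apply]
  by_cases h : i = j <;> by_cases h' : a = b <;> simp [h, h']

theorem aux_Omega_transpose (n : ℕ) : (Omega n)ᵀ = - Omega n := by
  unfold Omega
  ext ⟨i, a⟩ ⟨j, b⟩
  rw [transpose_apply, Matrix.neg_apply, kroneckerMap_apply, kroneckerMap_apply,
    one_apply, one_apply]
  by_cases h : i = j
  · subst h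
    fin_cases a <;> fin_cases b <;> simp [J2]
  · simp [h, Ne.symm h]

theorem aux_K_sq (n : ℕ) : auxK n * auxK n = 1 := by
  unfold auxK
  have h := congrArg (fun M => M.map Complex.ofReal) (aux_Omega_sq n)
  rw [show (Complex.ofReal : ℝ → ℂ) = Complex.ofRealHom from rfl] at *
  rw [Matrix.map_mul] at h
  rw [smul_mul_smul_comm, h, Complex.I_mul_I]
  ext i j
  by_cases hij : i = j <;> simp [one_apply, hij]

theorem aux_K_herm (n : ℕ) : (auxK n)ᴴ = auxK n := by
  have h := aux_Omega_transpose n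
  ext i j
  have hij : Omega n j i = - Omega n i j := by
    have := congrFun (congrFun h i) j
    simpa using this
  simp [auxK, hij]

theorem aux_decomp (n : ℕ) (A : Matrix (Fin n × Fin 2) (Fin n × Fin 2) ℝ) (hA : A.PosDef) :
    ∃ (C : Matrix (Fin n × Fin 2) (Fin n × Fin 2) ℂ) (l : Fin n × Fin 2 → ℝ),
      IsUnit C.det ∧ C * Cᴴ = A.map Complex.ofReal ∧
      Cᴴ * auxK n * C = diagonal (fun i => (l i : ℂ)) ∧
      gMinus (Omega n) A = (∑ j, max (-Real.log |l j|) 0) / 2 := by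
  have hms : msqrt A = hA.posSemidef.sqrt := by
    unfold msqrt
    rw [dif_pos hA.posSemidef]
  set T := (msqrt A).map Complex.ofReal with hT
  have hTT : T * T = A.map Complex.ofReal := by
    have : msqrt A * msqrt A = A := by rw [hms]; exact aux_sqrt_mul _
    conv_rhs => rw [← this]
    exact (Matrix.map_mul (f := Complex.ofRealHom)).symm
  have hTh : Tᴴ = T := by
    have : (msqrt A)ᴴ = msqrt A := by rw [hms]; exact aux_sqrt_herm _
    conv_rhs => rw [hT, ← this]
    ext i j
    simp [hT]
  have hAd : (A.map Complex.ofReal).det ≠ 0 := by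
    have := (RingHom.map_det Complex.ofRealHom A)
    rw [show A.map Complex.ofReal = Complex.ofRealHom.mapMatrix A from rfl, ← this]
    simpa using hA.det_pos.ne'
  have hTu : T.det ≠ 0 := by
    intro h
    rw [← hTT, det_mul, h, zero_mul] at hAd
    exact hAd rfl
  have hHe : Complex.I • ((msqrt A * Omega n * msqrt A).map Complex.ofReal) = T * auxK n * T := by
    have : (msqrt A * Omega n * msqrt A).map Complex.ofReal
        = T * (Omega n).map Complex.ofReal * T := by
      change (msqrt A * Omega n * msqrt A).map Complex.ofRealHom = _
      rw [Matrix.map_mul, Matrix.map_mul]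
      rfl
    rw [this, auxK]
    simp
  have hH : (Complex.I • ((msqrt A * Omega n * msqrt A).map Complex.ofReal)).IsHermitian := by
    rw [hHe]
    unfold Matrix.IsHermitian
    rw [conjTranspose_mul, conjTranspose_mul, hTh, aux_K_herm, Matrix.mul_assoc]
  obtain ⟨U, hU1, hU2, hU⟩ := aux_spectral hH
  refine ⟨T * U, hH.eigenvalues, ?_, ?_, ?_, ?_⟩
  · rw [isUnit_iff_ne_zero, det_mul]
    refine mul_ne_zero hTu fun h => ?_
    have := congrArg det hU1
    rw [det_mul, h, zero_mul, det_one] at this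
    exact zero_ne_one this
  · rw [conjTranspose_mul, hTh]
    calc T * U * (Uᴴ * T) = T * (U * Uᴴ) * T := by simp only [Matrix.mul_assoc]
      _ = _ := by rw [hU1, Matrix.mul_one, hTT]
  · rw [conjTranspose_mul, hTh]
    have hU' := hHe.symm.trans hU
    calc Uᴴ * T * auxK n * (T * U) = Uᴴ * (T * auxK n * T) * U := by
          simp only [Matrix.mul_assoc]
      _ = (Uᴴ * U) * diagonal (fun i => (hH.eigenvalues i : ℂ)) * (Uᴴ * U) := by
          rw [hU']; simp only [Matrix.mul_assoc]
      _ = _ := by rw [hU2, Matrix.one_mul, Matrix.mul_one]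
  · unfold gMinus
    rw [dif_pos hH]

theorem aux_l_ne {n : ℕ} {C : Matrix (Fin n × Fin 2) (Fin n × Fin 2) ℂ}
    {l : Fin n × Fin 2 → ℝ} (hC : IsUnit C.det)
    (h : Cᴴ * auxK n * C = diagonal (fun i => (l i : ℂ))) (i) : l i ≠ 0 := by
  have hK : (auxK n).det ≠ 0 := by
    intro h
    have := congrArg det (aux_K_sq n)
    rw [det_mul, h, zero_mul, det_one] at this
    exact zero_ne_one this
  have h1 := congrArg det h
  rw [det_mul, det_mul, det_conjTranspose, det_diagonal] at h1
  have h2 : ∏ i, (l i : ℂ) ≠ 0 := by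
    rw [← h1]
    exact mul_ne_zero (mul_ne_zero (star_ne_zero.2 hC.ne_zero) hK) hC.ne_zero
  exact_mod_cast (Finset.prod_ne_zero_iff.1 h2) i (Finset.mem_univ _)

/-- `K = C Λ⁻¹ Cᴴ`. -/
theorem aux_K_eq {n : ℕ} {C : Matrix (Fin n × Fin 2) (Fin n × Fin 2) ℂ}
    {l : Fin n × Fin 2 → ℝ} (hC : IsUnit C.det)
    (h : Cᴴ * auxK n * C = diagonal (fun i => (l i : ℂ))) :
    auxK n = C * diagonal (fun i => (((l i)⁻¹ : ℝ) : ℂ)) * Cᴴ := by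
  have hl := aux_l_ne hC h
  have h1 : diagonal (fun i => (((l i)⁻¹ : ℝ) : ℂ)) * diagonal (fun i => (l i : ℂ)) = 1 := by
    rw [diagonal_mul_diagonal, ← diagonal_one]
    congr 1
    funext i
    have : (l i : ℂ) ≠ 0 := by exact_mod_cast hl i
    push_cast
    exact inv_mul_cancel₀ this
  have h2 : (diagonal (fun i => (((l i)⁻¹ : ℝ) : ℂ)) * Cᴴ * auxK n) * C = 1 := by
    rw [← h1, ← h]
    simp only [Matrix.mul_assoc]
  have h3 : C * (diagonal (fun i => (((l i)⁻¹ : ℝ) : ℂ)) * Cᴴ * auxK n) = 1 :=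
    mul_eq_one_comm.1 h2
  calc auxK n = (C * (diagonal (fun i => (((l i)⁻¹ : ℝ) : ℂ)) * Cᴴ * auxK n)) * auxK n := by
        rw [h3, Matrix.one_mul]
    _ = C * diagonal (fun i => (((l i)⁻¹ : ℝ) : ℂ)) * Cᴴ * (auxK n * auxK n) := by
        simp only [Matrix.mul_assoc]
    _ = _ := by rw [aux_K_sq, Matrix.mul_one]

theorem aux_log_max (x : ℝ) (hx : x ≠ 0) :
    Real.log (max |x⁻¹| 1) = max (-Real.log |x|) 0 := by
  have h0 : 0 < |x⁻¹| := abs_pos.2 (inv_ne_zero hx)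
  have : -Real.log |x| = Real.log |x⁻¹| := by rw [abs_inv, Real.log_inv]
  rw [this]
  rcases le_total |x⁻¹| 1 with h | h
  · rw [max_eq_right h, Real.log_one, max_eq_right (Real.log_nonpos h0.le h)]
  · rw [max_eq_left h, max_eq_left (Real.log_nonneg h)]

theorem aux_map_posDef {n : ℕ} {A : Matrix (Fin n × Fin 2) (Fin n × Fin 2) ℝ} (hA : A.PosDef) :
    (A.map Complex.ofReal).PosDef := by
  obtain ⟨C, l, hC, hCC, -, -⟩ := aux_decomp n A hA
  rw [← hCC]
  have : (Cᴴᴴ * Cᴴ).PosDef := by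
    refine PosDef.conjTranspose_mul_self _ ?_
    rw [mulVec_injective_iff_isUnit, isUnit_iff_isUnit_det, det_conjTranspose]
    exact hC.star
  simpa using this

theorem aux_map_posSemidef {n : ℕ} {A : Matrix (Fin n × Fin 2) (Fin n × Fin 2) ℝ}
    (hA : A.PosSemidef) : (A.map Complex.ofReal).PosSemidef := by
  have h1 : hA.sqrt * hA.sqrt = A := aux_sqrt_mul _
  have h2 : hA.sqrtᴴ = hA.sqrt := aux_sqrt_herm _
  have h3 : A.map Complex.ofReal
      = (hA.sqrt.map Complex.ofReal)ᴴ * (hA.sqrt.map Complex.ofReal) := by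
    have : (hA.sqrt.map Complex.ofReal)ᴴ = hA.sqrt.map Complex.ofReal := by
      conv_rhs => rw [← h2]
      ext i j
      simp
    rw [this]
    conv_lhs => rw [← h1]
    exact Matrix.map_mul (f := Complex.ofRealHom)
  rw [h3]
  exact posSemidef_conjTranspose_mul_self _

/-- Upper bound in the variational formula. -/
theorem aux_upper {n : ℕ} {A : Matrix (Fin n × Fin 2) (Fin n × Fin 2) ℝ} (hA : A.PosDef)
    {m : Type*} [Fintype m] [DecidableEq m] (S : Matrix (Fin n × Fin 2) m ℂ)
    (hS : Function.Injective S.mulVec) (hSK : (Sᴴ * auxK n * S).det ≠ 0) :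
    Real.log ‖(Sᴴ * auxK n * S).det‖ - Real.log ‖(Sᴴ * A.map Complex.ofReal * S).det‖
      ≤ 2 * gMinus (Omega n) A := by
  have hpd := ((aux_map_posDef hA).conjTranspose_mul_mul_same hS).det_pos.ne'
  obtain ⟨C, l, hC, hCC, hCK, hg⟩ := aux_decomp n A hA
  have hl := aux_l_ne hC hCK
  have hK := aux_K_eq hC hCK
  have hb := aux_bound (Cᴴ * S) (fun i => (l i)⁻¹)
  have e1 : (Cᴴ * S)ᴴ * diagonal (fun i => (((l i)⁻¹ : ℝ) : ℂ)) * (Cᴴ * S)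
      = Sᴴ * auxK n * S := by
    rw [hK, conjTranspose_mul, conjTranspose_conjTranspose]
    simp only [Matrix.mul_assoc]
  have e2 : (Cᴴ * S)ᴴ * (Cᴴ * S) = Sᴴ * A.map Complex.ofReal * S := by
    rw [← hCC, conjTranspose_mul, conjTranspose_conjTranspose]
    simp only [Matrix.mul_assoc]
  rw [e1, e2] at hb
  have hpr : ∀ i ∈ Finset.univ, max |(l i)⁻¹| 1 ≠ 0 := fun i _ =>
    (lt_of_lt_of_le one_pos (le_max_right _ _)).ne'
  have := Real.log_le_log (norm_pos_iff.2 hSK) hb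
  rw [Real.log_mul (Finset.prod_ne_zero_iff.2 hpr) (norm_ne_zero_iff.2 hpd),
    Real.log_prod hpr, Finset.sum_congr rfl fun i _ => aux_log_max (l i) (hl i)] at this
  rw [hg]
  linarith

/-- The bound is attained. -/
theorem aux_attained {n : ℕ} {A : Matrix (Fin n × Fin 2) (Fin n × Fin 2) ℝ} (hA : A.PosDef) :
    ∃ (m : Finset (Fin n × Fin 2)) (S : Matrix (Fin n × Fin 2) m ℂ),
      Function.Injective S.mulVec ∧ (Sᴴ * auxK n * S).det ≠ 0 ∧
      2 * gMinus (Omega n) A = Real.log ‖(Sᴴ * auxK n * S).det‖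
        - Real.log ‖(Sᴴ * A.map Complex.ofReal * S).det‖ := by
  obtain ⟨C, l, hC, hCC, hCK, hg⟩ := aux_decomp n A hA
  have hl := aux_l_ne hC hCK
  have hK := aux_K_eq hC hCK
  have hi : C⁻¹ * C = 1 := nonsing_inv_mul _ hC
  have hih : Cᴴ * (C⁻¹)ᴴ = 1 := by rw [← conjTranspose_mul, hi, conjTranspose_one]
  let m : Finset (Fin n × Fin 2) := Finset.univ.filter fun j => |l j| < 1
  let E : Matrix (Fin n × Fin 2) m ℂ := (1 : Matrix _ _ ℂ).submatrix id Subtype.val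
  have hE : ∀ d : Fin n × Fin 2 → ℂ,
      Eᴴ * diagonal d * E = diagonal (fun j : m => d j) := by
    intro d
    have h1 : Eᴴ * diagonal d * E
        = ((1 : Matrix _ _ ℂ)ᴴ * diagonal d * 1).submatrix Subtype.val Subtype.val := rfl
    rw [h1, conjTranspose_one, Matrix.one_mul, Matrix.mul_one,
      submatrix_diagonal _ _ Subtype.val_injective]
    rfl
  have hE1 : Eᴴ * E = 1 := by
    have := hE (fun _ => 1)
    simpa using this
  have eK : ((C⁻¹)ᴴ * E)ᴴ * auxK n * ((C⁻¹)ᴴ * E)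
      = diagonal (fun j : m => (((l j)⁻¹ : ℝ) : ℂ)) := by
    rw [hK, conjTranspose_mul, conjTranspose_conjTranspose]
    calc Eᴴ * C⁻¹ * (C * diagonal (fun i => (((l i)⁻¹ : ℝ) : ℂ)) * Cᴴ) * ((C⁻¹)ᴴ * E)
        = Eᴴ * ((C⁻¹ * C) * diagonal (fun i => (((l i)⁻¹ : ℝ) : ℂ)) * (Cᴴ * (C⁻¹)ᴴ)) * E := by
          simp only [Matrix.mul_assoc]
      _ = _ := by rw [hi, hih, Matrix.one_mul, Matrix.mul_one, hE]
  have eA : ((C⁻¹)ᴴ * E)ᴴ * A.map Complex.ofReal * ((C⁻¹)ᴴ * E) = 1 := by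
    rw [← hCC, conjTranspose_mul, conjTranspose_conjTranspose]
    calc Eᴴ * C⁻¹ * (C * Cᴴ) * ((C⁻¹)ᴴ * E)
        = Eᴴ * ((C⁻¹ * C) * (Cᴴ * (C⁻¹)ᴴ)) * E := by
          simp only [Matrix.mul_assoc]
      _ = _ := by rw [hi, hih, Matrix.one_mul, Matrix.mul_one, hE1]
  refine ⟨m, (C⁻¹)ᴴ * E, ?_, ?_, ?_⟩
  · intro x y hxy
    have := congrArg (fun v => (((C⁻¹)ᴴ * E)ᴴ * A.map Complex.ofReal) *ᵥ v) hxy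
    simpa only [mulVec_mulVec, eA, one_mulVec] using this
  · rw [eK, det_diagonal]
    refine Finset.prod_ne_zero_iff.2 fun j _ => ?_
    exact_mod_cast inv_ne_zero (hl j)
  · rw [eK, eA, det_one, norm_one, Real.log_one, sub_zero, det_diagonal, ← Complex.ofReal_prod,
      Complex.norm_real, Real.norm_eq_abs, Real.log_abs,
      Real.log_prod (f := fun j : m => (l j)⁻¹) (fun j _ => inv_ne_zero (hl j)), hg, mul_div_cancel₀ _ two_ne_zero]
    rw [Finset.sum_coe_sort m (fun j => Real.log (l j)⁻¹), Finset.sum_filter]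
    refine Finset.sum_congr rfl fun j _ => ?_
    have hp : 0 < |l j| := abs_pos.2 (hl j)
    split_ifs with h
    · rw [max_eq_left, Real.log_inv, Real.log_abs]
      linarith [Real.log_nonpos hp.le h.le]
    · rw [max_eq_right]
      linarith [Real.log_nonneg (not_lt.1 h)]

/-- **`g₋` is monotonically decreasing and convex** on the cone of `2n×2n` real symmetric
positive definite matrices (symplectic eigenvalues taken w.r.t. the standard symplectic
form `Ω_n`). -/
theorem gMinus_antitone_and_convex (n : ℕ) :
    (∀ A B : Matrix (Fin n × Fin 2) (Fin n × Fin 2) ℝ,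
      A.PosDef → B.PosDef → (B - A).PosSemidef →
      gMinus (Omega n) B ≤ gMinus (Omega n) A) ∧
    (∀ A B : Matrix (Fin n × Fin 2) (Fin n × Fin 2) ℝ, ∀ p : ℝ,
      A.PosDef → B.PosDef → 0 ≤ p → p ≤ 1 →
      gMinus (Omega n) (p • A + (1 - p) • B)
        ≤ p * gMinus (Omega n) A + (1 - p) * gMinus (Omega n) B) := by
  constructor
  · intro A B hA hB hAB
    obtain ⟨m, S, hS, hSK, hg⟩ := aux_attained hB
    have hu := aux_upper hA S hS hSK
    have hsub : (Sᴴ * B.map Complex.ofReal * S - Sᴴ * A.map Complex.ofReal * S).PosSemidef := by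
      have h := (aux_map_posSemidef hAB).conjTranspose_mul_mul_same S
      have e : (B - A).map Complex.ofReal = B.map Complex.ofReal - A.map Complex.ofReal := by
        ext i j
        simp
      rwa [e, Matrix.mul_sub, Matrix.sub_mul] at h
    have := aux_logdet_mono ((aux_map_posDef hA).conjTranspose_mul_mul_same hS)
      ((aux_map_posDef hB).conjTranspose_mul_mul_same hS) hsub
    linarith
  · intro A B p hA hB hp0 hp1
    have hM : (p • A + (1 - p) • B).PosDef := by
      rcases hp0.eq_or_lt with h | h
      · subst h; simpa using hB
      · exact (hA.smul h).add_posSemidef (hB.posSemidef.smul (sub_nonneg.2 hp1))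
    obtain ⟨m, S, hS, hSK, hg⟩ := aux_attained hM
    have huA := aux_upper hA S hS hSK
    have huB := aux_upper hB S hS hSK
    have hc := aux_logdet_concave ((aux_map_posDef hA).conjTranspose_mul_mul_same hS)
      ((aux_map_posDef hB).conjTranspose_mul_mul_same hS) hp0 hp1
    have e : Sᴴ * (p • A + (1 - p) • B).map Complex.ofReal * S
        = (p : ℂ) • (Sᴴ * A.map Complex.ofReal * S)
          + ((1 - p : ℝ) : ℂ) • (Sᴴ * B.map Complex.ofReal * S) := by
      have e1 : (p • A + (1 - p) • B).map Complex.ofReal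
          = (p : ℂ) • A.map Complex.ofReal + ((1 - p : ℝ) : ℂ) • B.map Complex.ofReal := by
        ext i j
        simp
      rw [e1, Matrix.mul_add, Matrix.add_mul, Matrix.mul_smul, Matrix.mul_smul,
        Matrix.smul_mul, Matrix.smul_mul]
    rw [e] at hg
    have h1 := mul_le_mul_of_nonneg_left huA hp0
    have h2 := mul_le_mul_of_nonneg_left huB (sub_nonneg.2 hp1)
    nlinarith [h1, h2, hc, hg]

end
end

section
/- For a real number α > 1, define f_α : [0,∞) → ℝ by f_α(x) = −(1/(α−1)) · log( 2^α / ((e^x + 1)^α − (e^x − 1)^α) ). Then f_α is convex on [0,∞) if and only if α ≥ 2. -/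
open Matrix
open scoped ComplexOrder Kronecker

noncomputable section

/-- The auxiliary ratio controlling the derivative. -/
def phiAux (p t : ℝ) : ℝ := (t - t ^ p) / (1 - t ^ (p + 1))

theorem K_nonneg (p : ℝ) (hp : 1 ≤ p) (t : ℝ) (ht : t ∈ Set.Ioo (0 : ℝ) 1) :
    0 ≤ 1 - p * t ^ (p - 1) + p * t ^ (p + 1) - t ^ (2 * p) := by
  have hd : ∀ s ∈ Set.Ioi (0 : ℝ), HasDerivAt
      (fun t : ℝ => 1 - p * t ^ (p - 1) + p * t ^ (p + 1) - t ^ (2 * p))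
      (- (p * ((p - 1) * s ^ (p - 1 - 1))) + p * ((p + 1) * s ^ (p + 1 - 1))
        - (2 * p) * s ^ (2 * p - 1)) s := by
    intro s hs
    have hs0 : s ≠ 0 := ne_of_gt hs
    have h1 := (Real.hasDerivAt_rpow_const (x := s) (p := p - 1) (Or.inl hs0)).const_mul p
    have h2 := (Real.hasDerivAt_rpow_const (x := s) (p := p + 1) (Or.inl hs0)).const_mul p
    have h3 := (Real.hasDerivAt_rpow_const (x := s) (p := 2 * p) (Or.inl hs0))
    exact (((h1.const_sub 1).add h2).sub h3)
  have hanti : AntitoneOn (fun t : ℝ => 1 - p * t ^ (p - 1) + p * t ^ (p + 1) - t ^ (2 * p))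
      (Set.Ioc (0 : ℝ) 1) := by
    apply antitoneOn_of_deriv_nonpos (convex_Ioc 0 1)
    · intro s hs
      exact (hd s hs.1).continuousAt.continuousWithinAt
    · intro s hs
      rw [interior_Ioc] at hs
      exact (hd s hs.1).differentiableAt.differentiableWithinAt
    · intro s hs
      rw [interior_Ioc] at hs
      have hs0 : 0 < s := hs.1
      rw [(hd s hs.1).deriv]
      have e1 : s ^ (p + 1 - 1) = s ^ (p - 1 - 1) * s ^ 2 := by
        rw [← Real.rpow_natCast s 2, ← Real.rpow_add hs0]; congr 1; push_cast; ring
      have e2 : s ^ (2 * p - 1) = s ^ (p - 1 - 1) * (s ^ 2) ^ ((p + 1) / 2) := by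
        rw [← Real.rpow_natCast s 2, ← Real.rpow_mul hs0.le, ← Real.rpow_add hs0]
        congr 1; push_cast; ring
      have hb := one_add_mul_self_le_rpow_one_add (s := s ^ 2 - 1) (by nlinarith [sq_nonneg s])
        (p := (p + 1) / 2) (by linarith)
      rw [show 1 + (s ^ 2 - 1) = s ^ 2 by ring] at hb
      have hq : 0 < s ^ (p - 1 - 1) := Real.rpow_pos_of_pos hs0 _
      rw [e1, e2]
      have : 0 ≤ p * s ^ (p - 1 - 1) *
          (2 * ((s ^ 2) ^ ((p + 1) / 2) - (1 + (p + 1) / 2 * (s ^ 2 - 1)))) := by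
        have : 0 ≤ (s ^ 2) ^ ((p + 1) / 2) - (1 + (p + 1) / 2 * (s ^ 2 - 1)) := by linarith
        positivity
      nlinarith
  have := hanti ⟨ht.1, ht.2.le⟩ ⟨one_pos, le_refl 1⟩ ht.2.le
  simp only [Real.one_rpow] at this
  linarith

theorem phiAux_mono (p : ℝ) (hp : 1 ≤ p) : MonotoneOn (phiAux p) (Set.Ico (0 : ℝ) 1) := by
  have hlt : ∀ s ∈ Set.Ico (0 : ℝ) 1, s ^ (p + 1) < 1 := fun s hs =>
    Real.rpow_lt_one hs.1 hs.2 (by linarith)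
  have hd : ∀ s ∈ Set.Ico (0 : ℝ) 1, HasDerivAt (phiAux p)
      (((1 - p * s ^ (p - 1)) * (1 - s ^ (p + 1)) - (s - s ^ p) * (-((p + 1) * s ^ (p + 1 - 1))))
        / (1 - s ^ (p + 1)) ^ 2) s := by
    intro s hs
    have h1 := (hasDerivAt_id s).sub (Real.hasDerivAt_rpow_const (x := s) (p := p) (Or.inr hp))
    have h2 := (Real.hasDerivAt_rpow_const (x := s) (p := p + 1)
      (Or.inr (by linarith))).const_sub 1
    exact h1.div h2 (by have := hlt s hs; linarith)
  apply monotoneOn_of_deriv_nonneg (convex_Ico 0 1)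
  · intro s hs
    exact (hd s hs).continuousAt.continuousWithinAt
  · intro s hs
    rw [interior_Ico] at hs
    exact (hd s ⟨hs.1.le, hs.2⟩).differentiableAt.differentiableWithinAt
  · intro s hs
    rw [interior_Ico] at hs
    rw [(hd s ⟨hs.1.le, hs.2⟩).deriv]
    have hs0 : 0 < s := hs.1
    apply div_nonneg _ (sq_nonneg _)
    have hK := K_nonneg p hp s hs
    have e1 : s ^ (p + 1) = s ^ p * s := Real.rpow_add_one hs0.ne' p
    have e2 : s ^ (2 * p) = s ^ p * s ^ p := by rw [← Real.rpow_add hs0]; congr 1; ring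
    have e3 : s ^ p = s ^ (p - 1) * s := by
      rw [← Real.rpow_add_one hs0.ne']; congr 1; ring
    rw [add_sub_cancel_right, e1]
    rw [e1, e2] at hK
    have : (1 - p * s ^ (p - 1)) * (1 - s ^ p * s) - (s - s ^ p) * (-((p + 1) * s ^ p)) =
      1 - p * s ^ (p - 1) + p * (s ^ p * s) - s ^ p * s ^ p := by
      rw [e3]; ring
    linarith

theorem G_pos (α : ℝ) (hα : 1 < α) (x : ℝ) (hx : 0 ≤ x) :
    0 < (Real.exp x + 1) ^ α - (Real.exp x - 1) ^ α := by
  have h1 : 1 ≤ Real.exp x := Real.one_le_exp hx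
  have := Real.rpow_lt_rpow (x := Real.exp x - 1) (y := Real.exp x + 1) (z := α)
    (by linarith) (by linarith) (by linarith)
  linarith

theorem tAux_mem (x : ℝ) (hx : 0 ≤ x) :
    (Real.exp x - 1) / (Real.exp x + 1) ∈ Set.Ico (0 : ℝ) 1 := by
  have h1 : 1 ≤ Real.exp x := Real.one_le_exp hx
  refine ⟨div_nonneg (by linarith) (by linarith), ?_⟩
  rw [div_lt_one (by linarith)]; linarith

theorem f_hasDeriv (α : ℝ) (hα : 1 < α) (x : ℝ) (hx : 0 ≤ x) :
    HasDerivAt (fun x : ℝ => -(1 / (α - 1)) *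
          Real.log ((2 : ℝ) ^ α / ((Real.exp x + 1) ^ α - (Real.exp x - 1) ^ α)))
      (1 / (α - 1) * (α / 2 * (1 + phiAux (α - 1) ((Real.exp x - 1) / (Real.exp x + 1))))) x := by
  have hG := G_pos α hα x hx
  have h2 : (0 : ℝ) < 2 ^ α := Real.rpow_pos_of_pos two_pos _
  have d1 := ((Real.hasDerivAt_exp x).add_const 1).rpow_const (p := α) (Or.inr hα.le)
  have d2 := ((Real.hasDerivAt_exp x).sub_const 1).rpow_const (p := α) (Or.inr hα.le)
  have d3 := (((hasDerivAt_const x ((2 : ℝ) ^ α)).div (d1.sub d2) hG.ne').log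
    (div_pos h2 hG).ne').const_mul (-(1 / (α - 1)))
  refine HasDerivAt.congr_deriv d3 ?_
  symm
  simp only [Pi.sub_apply, Pi.div_apply]
  obtain ⟨ht0, ht1⟩ := tAux_mem x hx
  set t := (Real.exp x - 1) / (Real.exp x + 1) with ht
  set ν := Real.exp x with hν
  have hν1 : 0 < ν + 1 := by have := Real.exp_pos x; linarith
  have em : ν - 1 = t * (ν + 1) := by rw [ht]; field_simp
  have ea : (ν + 1) ^ α = (ν + 1) ^ (α - 1) * (ν + 1) := by
    rw [← Real.rpow_add_one hν1.ne']; congr 1; ring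
  have et : t ^ α = t ^ (α - 1) * t := by
    rw [← Real.rpow_add_one' ht0 (by linarith)]; congr 1; ring
  have hA : 0 < (ν + 1) ^ (α - 1) := Real.rpow_pos_of_pos hν1 _
  have htl : t ^ α < 1 := Real.rpow_lt_one ht0 ht1 (by linarith)
  rw [em, Real.mul_rpow ht0 hν1.le, Real.mul_rpow ht0 hν1.le, phiAux, sub_add_cancel]
  rw [et] at htl ⊢
  rw [ea]
  have hν' : ν = (1 + t) / (1 - t) := by
    rw [eq_div_iff (by linarith)]; linarith
  generalize t ^ (α - 1) = T at *
  generalize (ν + 1) ^ (α - 1) = A at *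
  have hT : 1 - T * t ≠ 0 := by linarith
  have ha : α - 1 ≠ 0 := by linarith
  have h1t : 1 - t ≠ 0 := by linarith
  have hν1' := hν1.ne'
  have hden : A * (ν + 1) - T * t * (A * (ν + 1)) = A * (ν + 1) * (1 - T * t) := by ring
  rw [hden]
  have key : ν * 2 = (1 + t) * (ν + 1) := by linarith
  obtain ⟨D, hD⟩ : ∃ D, D = 1 - T * t := ⟨_, rfl⟩
  rw [← hD] at hT ⊢
  generalize (2 : ℝ) ^ α = B at h2 ⊢
  clear d1 d2 d3 hden et ea hν' hG ht hν
  clear_value t ν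
  have hB := h2.ne'
  have hA' := hA.ne'
  field_simp
  rw [hD]
  linear_combination (-(α * B * (1 - T))) * key

theorem fAlpha_convex_iff (α : ℝ) (hα : 1 < α) :
    ConvexOn ℝ (Set.Ici (0 : ℝ))
        (fun x : ℝ => -(1 / (α - 1)) *
          Real.log ((2 : ℝ) ^ α / ((Real.exp x + 1) ^ α - (Real.exp x - 1) ^ α)))
      ↔ 2 ≤ α := by
  have hc : 0 < 1 / (α - 1) := by apply one_div_pos.mpr; linarith
  constructor
  · intro h
    by_contra! hlt
    have a1 := h.le_slope_of_hasDerivAt (x := 0) (y := 1) (by simp) (by simp) one_pos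
      (f_hasDeriv α hα 0 le_rfl)
    have a2 := h.slope_le_of_hasDerivAt (x := 0) (y := 1) (by simp) (by simp) one_pos
      (f_hasDeriv α hα 1 zero_le_one)
    have a3 := a1.trans a2
    have a4 := le_of_mul_le_mul_left a3 hc
    have a5 := le_of_mul_le_mul_left a4 (by linarith)
    have e0 : phiAux (α - 1) ((Real.exp 0 - 1) / (Real.exp 0 + 1)) = 0 := by
      simp [phiAux, Real.zero_rpow (show α - 1 ≠ 0 by linarith)]
    obtain ⟨ht0, ht1⟩ := tAux_mem 1 zero_le_one
    have htp : 0 < (Real.exp 1 - 1) / (Real.exp 1 + 1) := by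
      have : 1 < Real.exp 1 := Real.one_lt_exp_iff.mpr one_pos
      apply div_pos <;> linarith
    have : phiAux (α - 1) ((Real.exp 1 - 1) / (Real.exp 1 + 1)) < 0 := by
      unfold phiAux
      generalize (Real.exp 1 - 1) / (Real.exp 1 + 1) = t at *
      apply div_neg_of_neg_of_pos
      · have := Real.rpow_lt_rpow_of_exponent_gt htp ht1 (show α - 1 < 1 by linarith)
        rw [Real.rpow_one] at this
        linarith
      · have := Real.rpow_lt_one ht0 ht1 (show 0 < α - 1 + 1 by linarith)
        linarith
    linarith
  · intro h2
    apply MonotoneOn.convexOn_of_deriv (convex_Ici 0)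
    · intro s hs
      exact (f_hasDeriv α hα s hs).continuousAt.continuousWithinAt
    · intro s hs
      rw [interior_Ici] at hs
      exact (f_hasDeriv α hα s (le_of_lt hs)).differentiableAt.differentiableWithinAt
    · intro x hx y hy hxy
      rw [interior_Ici] at hx hy
      have hx0 : 0 ≤ x := le_of_lt hx
      have hy0 : 0 ≤ y := le_of_lt hy
      rw [(f_hasDeriv α hα x hx0).deriv, (f_hasDeriv α hα y hy0).deriv]
      apply mul_le_mul_of_nonneg_left _ hc.le
      apply mul_le_mul_of_nonneg_left _ (by linarith)
      have := phiAux_mono (α - 1) (by linarith) (tAux_mem x hx0) (tAux_mem y hy0) (by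
        have := Real.exp_le_exp.mpr hxy
        have := Real.exp_pos x
        rw [div_le_div_iff₀ (by linarith) (by linarith)]
        nlinarith)
      linarith

end
end
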